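/- For every balanced pair (k, m) there exists a balanced pair (k′, m) of the same order m such that D_j(k′/2^{2m}) = |D_j(k/2^{2m})| for all 1 ≤ j ≤ 2m (so that (k′, m) is principal and has the same generation as (k, m)), f(k/2^{2m}) = f(k′/2^{2m}), and the images satisfy f(I(k, m)) = f(I(k′, m)). -/

import Mathlib

/-- `phi x` is the distance from `x` to the nearest integer. -/
noncomputable def phi (x : ℝ) : ℝ := |x - round x|

/-- The signed Takagi function associated to the sign sequence `r`. -/
noncomputable def takagi (r : ℕ → ℝ) (x : ℝ) : ℝ :=
  ∑' n : ℕ, r n / 2 ^ n * phi (2 ^ n * x)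

/-- `eps n x` is the `n`-th binary digit of `x ∈ [0,1)` (for `n ≥ 1`), using the
terminating expansion for dyadic rationals. -/
noncomputable def eps (n : ℕ) (x : ℝ) : ℕ := (⌊2 ^ n * x⌋ % 2).toNat

/-- `Dfun r k x = ∑_{j=1}^k r_{j-1} (-1)^{ε_j(x)}`. -/
noncomputable def Dfun (r : ℕ → ℝ) (k : ℕ) (x : ℝ) : ℝ :=
  ∑ j ∈ Finset.Icc 1 k, r (j - 1) * (-1 : ℝ) ^ eps j x

/-- `(k, m)` is a balanced pair if `0 ≤ k < 2^{2m}` and `D_{2m}(k/2^{2m}) = 0`. -/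
def BalancedPair (r : ℕ → ℝ) (k m : ℕ) : Prop :=
  k < 2 ^ (2 * m) ∧ Dfun r (2 * m) ((k : ℝ) / 2 ^ (2 * m)) = 0

/-- The generation of a balanced pair `(k, m)`: the number of indices
`1 ≤ j ≤ 2m` with `D_j(k/2^{2m}) = 0`. -/
noncomputable def generation (r : ℕ → ℝ) (k m : ℕ) : ℕ :=
  {j : ℕ | 1 ≤ j ∧ j ≤ 2 * m ∧ Dfun r j ((k : ℝ) / 2 ^ (2 * m)) = 0}.ncard

/-- The integer whose binary digits, from the most significant one, are `e 1, …, e n`. -/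
def ofDigitsPrefix (e : ℕ → ℕ) : ℕ → ℕ
  | 0 => 0
  | n + 1 => 2 * ofDigitsPrefix e n + e (n + 1)

lemma ofDigitsPrefix_bounds {e : ℕ → ℕ} (he : ∀ j, e j ≤ 1) (j i : ℕ) :
    2 ^ i * ofDigitsPrefix e j ≤ ofDigitsPrefix e (j + i) ∧
      ofDigitsPrefix e (j + i) < 2 ^ i * (ofDigitsPrefix e j + 1) := by
  induction i with
  | zero => simp
  | succ i ih =>
    have := he (j + i + 1)
    rw [← add_assoc, ofDigitsPrefix, pow_succ']
    constructor <;> nlinarith [ih.1, ih.2]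

lemma ofDigitsPrefix_lt {e : ℕ → ℕ} (he : ∀ j, e j ≤ 1) (n : ℕ) :
    ofDigitsPrefix e n < 2 ^ n := by
  simpa [ofDigitsPrefix] using (ofDigitsPrefix_bounds he 0 n).2

lemma floor_ofDigitsPrefix_div {e : ℕ → ℕ} (he : ∀ j, e j ≤ 1) {j n : ℕ} (hj : j ≤ n) :
    ⌊(2 : ℝ) ^ j * ((ofDigitsPrefix e n : ℝ) / 2 ^ n)⌋ = ofDigitsPrefix e j := by
  obtain ⟨i, rfl⟩ := Nat.exists_eq_add_of_le hj
  obtain ⟨h1, h2⟩ := ofDigitsPrefix_bounds he j i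
  have h1' : (2 : ℝ) ^ i * ofDigitsPrefix e j ≤ ofDigitsPrefix e (j + i) := by exact_mod_cast h1
  have h2' : (ofDigitsPrefix e (j + i) : ℝ) < 2 ^ i * (ofDigitsPrefix e j + 1) := by
    exact_mod_cast h2
  have hrw : (2 : ℝ) ^ j * ((ofDigitsPrefix e (j + i) : ℝ) / 2 ^ (j + i)) =
      ofDigitsPrefix e (j + i) / 2 ^ i := by
    rw [pow_add]; field_simp
  have hp : (0 : ℝ) < 2 ^ i := by positivity
  rw [hrw, Int.floor_eq_iff, le_div_iff₀ hp, div_lt_iff₀ hp]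
  push_cast
  constructor <;> linarith

lemma eps_ofDigitsPrefix_div {e : ℕ → ℕ} (he : ∀ j, e j ≤ 1) {j n : ℕ} (hj : j + 1 ≤ n) :
    eps (j + 1) ((ofDigitsPrefix e n : ℝ) / 2 ^ n) = e (j + 1) := by
  have := he (j + 1)
  rw [eps, floor_ofDigitsPrefix_div he hj, ofDigitsPrefix]
  omega

lemma eps_eq_zero_or_one (n : ℕ) (x : ℝ) : eps n x = 0 ∨ eps n x = 1 := by
  unfold eps; omega

lemma floor_two_pow_succ_mul (j : ℕ) (x : ℝ) :
    ⌊(2 : ℝ) ^ (j + 1) * x⌋ = 2 * ⌊(2 : ℝ) ^ j * x⌋ + (eps (j + 1) x : ℤ) := by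
  have h : ⌊(2 : ℝ) ^ (j + 1) * x⌋ / 2 = ⌊(2 : ℝ) ^ j * x⌋ := by
    rw [pow_succ', mul_assoc]
    exact_mod_cast Int.natCast_mul_floor_div_cancel two_ne_zero ((2 : ℝ) ^ j * x)
  unfold eps
  omega

lemma neg_one_pow_eps (n : ℕ) (x : ℝ) : (-1 : ℝ) ^ eps n x = 1 - 2 * eps n x := by
  rcases eps_eq_zero_or_one n x with h | h <;> rw [h] <;> norm_num

lemma phi_int_add (z : ℤ) (x : ℝ) : phi (z + x) = phi x := by
  unfold phi
  rw [round_intCast_add]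
  push_cast
  congr 1
  ring

lemma phi_nonneg (x : ℝ) : 0 ≤ phi x := abs_nonneg _

lemma phi_le_half (x : ℝ) : phi x ≤ 1 / 2 := abs_sub_round x

lemma phi_eq_of_le_half {x : ℝ} (h0 : 0 ≤ x) (h1 : x ≤ 1 / 2) : phi x = x := by
  unfold phi
  rw [abs_sub_round_eq_min, Int.fract_eq_self.2 ⟨h0, by linarith⟩]
  exact min_eq_left (by linarith)

lemma phi_eq_of_half_le {x : ℝ} (h0 : 1 / 2 ≤ x) (h1 : x ≤ 1) : phi x = 1 - x := by
  have h : phi x = phi (1 - x) := by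
    rcases eq_or_lt_of_le h1 with rfl | h1
    · simp [phi]
    · unfold phi
      rw [abs_sub_round_eq_min, abs_sub_round_eq_min, Int.fract_eq_self.2 ⟨by linarith, h1⟩,
        Int.fract_eq_self.2 ⟨by linarith, by linarith⟩, min_comm]
      congr 1
      ring
  rw [h, phi_eq_of_le_half (by linarith) (by linarith)]

lemma phi_half_add (n : ℕ) (x : ℝ) {t : ℝ} (h0 : 0 ≤ t) (h1 : t ≤ 1) :
    phi ((eps n x + t) / 2) = 1 / 4 + (-1) ^ eps n x * (t - 1 / 2) / 2 := by
  rcases eps_eq_zero_or_one n x with h | h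
  · rw [h, phi_eq_of_le_half (by push_cast; linarith) (by push_cast; linarith)]
    push_cast; ring
  · rw [h, phi_eq_of_half_le (by push_cast; linarith) (by push_cast; linarith)]
    push_cast; ring

lemma Dfun_zero (r : ℕ → ℝ) (x : ℝ) : Dfun r 0 x = 0 := by simp [Dfun]

lemma Dfun_succ (r : ℕ → ℝ) (j : ℕ) (x : ℝ) :
    Dfun r (j + 1) x = Dfun r j x + r j * (-1) ^ eps (j + 1) x := by
  unfold Dfun
  rw [Finset.sum_Icc_succ_top (by omega)]
  simp

lemma exists_int_Dfun {r : ℕ → ℝ} (hr : ∀ n, r n = 1 ∨ r n = -1) (j : ℕ) (x : ℝ) :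
    ∃ d : ℤ, Dfun r j x = d := by
  induction j with
  | zero => exact ⟨0, by simp [Dfun_zero]⟩
  | succ j ih =>
    obtain ⟨d, hd⟩ := ih
    rw [Dfun_succ, hd]
    rcases hr j with h | h <;> rcases neg_one_pow_eq_or ℝ (eps (j + 1) x) with h' | h' <;>
      rw [h, h']
    · exact ⟨d + 1, by push_cast; ring⟩
    · exact ⟨d - 1, by push_cast; ring⟩
    · exact ⟨d - 1, by push_cast; ring⟩
    · exact ⟨d + 1, by push_cast; ring⟩

/-- The value of the `j`-th partial sum of the signed Takagi function at the midpoint of the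
dyadic interval of order `j` containing `x`. -/
noncomputable def midpointValue (r : ℕ → ℝ) (j : ℕ) (x : ℝ) : ℝ :=
  ∑ n ∈ Finset.range j, (r n - (-1) ^ eps (n + 1) x * Dfun r n x) / 2 ^ (n + 2)

/-- The `j`-th partial sum is affine with slope `D_j` on dyadic intervals of order `j`. -/
lemma partialSum_eq (r : ℕ → ℝ) (j : ℕ) (x : ℝ) {t : ℝ} (h0 : 0 ≤ t) (h1 : t ≤ 1) :
    ∑ n ∈ Finset.range j, r n / 2 ^ n * phi (2 ^ n * ((⌊(2 : ℝ) ^ j * x⌋ + t) / 2 ^ j)) =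
      midpointValue r j x + Dfun r j x * (t - 1 / 2) / 2 ^ j := by
  induction j generalizing t with
  | zero => simp [midpointValue, Dfun_zero]
  | succ j ih =>
    have he : (eps (j + 1) x : ℝ) = 0 ∨ (eps (j + 1) x : ℝ) = 1 := by
      exact_mod_cast eps_eq_zero_or_one (j + 1) x
    have hpt : ((⌊(2 : ℝ) ^ (j + 1) * x⌋ : ℝ) + t) / 2 ^ (j + 1) =
        (⌊(2 : ℝ) ^ j * x⌋ + (eps (j + 1) x + t) / 2) / 2 ^ j := by
      rw [floor_two_pow_succ_mul, pow_succ]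
      push_cast
      field_simp
      ring
    have hlast : (2 : ℝ) ^ j * ((⌊(2 : ℝ) ^ j * x⌋ + (eps (j + 1) x + t) / 2) / 2 ^ j) =
        ⌊(2 : ℝ) ^ j * x⌋ + (eps (j + 1) x + t) / 2 := by
      field_simp
    rw [hpt, Finset.sum_range_succ, ih (t := (eps (j + 1) x + t) / 2)
      (by rcases he with h | h <;> rw [h] <;> linarith)
      (by rcases he with h | h <;> rw [h] <;> linarith), hlast, phi_int_add,
      phi_half_add _ _ h0 h1, midpointValue, midpointValue, Finset.sum_range_succ, Dfun_succ,
      neg_one_pow_eps, pow_add, pow_add]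
    field_simp
    ring

lemma summable_takagi {r : ℕ → ℝ} (hr : ∀ n, r n = 1 ∨ r n = -1) (x : ℝ) :
    Summable fun n : ℕ => r n / 2 ^ n * phi (2 ^ n * x) := by
  refine Summable.of_norm_bounded summable_geometric_two fun n => ?_
  have hn : |r n| = 1 := by rcases hr n with h | h <;> simp [h]
  rw [Real.norm_eq_abs, abs_mul, abs_div, hn, abs_of_nonneg (phi_nonneg _),
    abs_of_pos (by positivity : (0 : ℝ) < 2 ^ n), one_div_pow]
  have := phi_le_half (2 ^ n * x)
  exact mul_le_of_le_one_right (by positivity) (by linarith)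

/-- On a dyadic interval with balanced left endpoint, the signed Takagi function is a translate
of a function which does not depend on the interval. -/
lemma takagi_add_div_of_Dfun_eq_zero {r : ℕ → ℝ} (hr : ∀ n, r n = 1 ∨ r n = -1) {k N : ℕ}
    (hD : Dfun r N ((k : ℝ) / 2 ^ N) = 0) {t : ℝ} (h0 : 0 ≤ t) (h1 : t ≤ 1) :
    takagi r (((k : ℝ) + t) / 2 ^ N) = midpointValue r N ((k : ℝ) / 2 ^ N) +
      ∑' n : ℕ, r (n + N) / 2 ^ (n + N) * phi (2 ^ n * t) := by
  have hS := partialSum_eq r N ((k : ℝ) / 2 ^ N) h0 h1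
  have hfl : ⌊(2 : ℝ) ^ N * ((k : ℝ) / 2 ^ N)⌋ = (k : ℤ) := by
    rw [mul_div_cancel₀ _ (by positivity), Int.floor_natCast]
  rw [hfl, hD] at hS
  push_cast at hS
  rw [takagi, ← (summable_takagi hr _).sum_add_tsum_nat_add N, hS]
  congr 1
  · ring
  · refine tsum_congr fun n => ?_
    rw [← phi_int_add (2 ^ n * k) (2 ^ n * t)]
    congr 2
    push_cast
    rw [pow_add]
    field_simp

lemma midpointValue_congr {r : ℕ → ℝ} (hr : ∀ n, r n = 1 ∨ r n = -1) {N : ℕ} {x y : ℝ}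
    (h : ∀ j ≤ N, Dfun r j y = |Dfun r j x|) : midpointValue r N y = midpointValue r N x := by
  refine Finset.sum_congr rfl fun n hn => ?_
  have key : ∀ z, (-1) ^ eps (n + 1) z * Dfun r n z =
      r n * (Dfun r (n + 1) z ^ 2 - Dfun r n z ^ 2 - 1) / 2 := by
    intro z
    rw [Dfun_succ]
    rcases hr n with h | h <;> rcases neg_one_pow_eq_or ℝ (eps (n + 1) z) with h' | h' <;>
      rw [h, h'] <;> ring
  have hn := Finset.mem_range.1 hn
  rw [key, key, h n hn.le, h (n + 1) hn, sq_abs, sq_abs]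

lemma abs_Dfun_step {r : ℕ → ℝ} (hr : ∀ n, r n = 1 ∨ r n = -1) (j : ℕ) (x : ℝ) :
    r j * (|Dfun r (j + 1) x| - |Dfun r j x|) = 1 ∨
      r j * (|Dfun r (j + 1) x| - |Dfun r j x|) = -1 := by
  obtain ⟨d, hd⟩ := exists_int_Dfun hr j x
  obtain ⟨d', hd'⟩ := exists_int_Dfun hr (j + 1) x
  have hstep : d' = d + 1 ∨ d' = d - 1 := by
    have h := Dfun_succ r j x
    rw [hd, hd'] at h
    rcases hr j with h1 | h1 <;> rcases neg_one_pow_eq_or ℝ (eps (j + 1) x) with h2 | h2 <;>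
      rw [h1, h2] at h
    · exact Or.inl (by exact_mod_cast (by linarith : (d' : ℝ) = d + 1))
    · exact Or.inr (by exact_mod_cast (by linarith : (d' : ℝ) = d - 1))
    · exact Or.inr (by exact_mod_cast (by linarith : (d' : ℝ) = d - 1))
    · exact Or.inl (by exact_mod_cast (by linarith : (d' : ℝ) = d + 1))
  have habs : |d'| - |d| = 1 ∨ |d'| - |d| = -1 := by
    rcases abs_cases d with h | h <;> rcases abs_cases d' with h' | h' <;> omega
  have habs' : |(d' : ℝ)| - |(d : ℝ)| = 1 ∨ |(d' : ℝ)| - |(d : ℝ)| = -1 := by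
    exact_mod_cast habs
  rw [hd, hd']
  rcases hr j with h | h <;> rcases habs' with h' | h' <;> rw [h, h'] <;> norm_num

/-- Reflecting the walk `j ↦ D_j(x)` at zero gives the walk of a dyadic rational. -/
lemma exists_Dfun_eq_abs {r : ℕ → ℝ} (hr : ∀ n, r n = 1 ∨ r n = -1) (x : ℝ) (N : ℕ) :
    ∃ k : ℕ, k < 2 ^ N ∧ ∀ j ≤ N, Dfun r j ((k : ℝ) / 2 ^ N) = |Dfun r j x| := by
  let e : ℕ → ℕ := fun j => if r (j - 1) * (|Dfun r j x| - |Dfun r (j - 1) x|) = 1 then 0 else 1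
  have he : ∀ j, e j ≤ 1 := fun j => by
    simp only [e]
    split_ifs <;> simp
  have hpow : ∀ j, (-1 : ℝ) ^ e (j + 1) = r j * (|Dfun r (j + 1) x| - |Dfun r j x|) := fun j => by
    rcases abs_Dfun_step hr j x with h | h <;> simp only [e, Nat.add_sub_cancel, h] <;> norm_num
  refine ⟨ofDigitsPrefix e N, ofDigitsPrefix_lt he N, fun j => ?_⟩
  induction j with
  | zero => simp [Dfun_zero]
  | succ j ih =>
    intro hj
    have hsq : r j * r j = 1 := by rcases hr j with h | h <;> rw [h] <;> norm_num
    rw [Dfun_succ, ih (by omega), eps_ofDigitsPrefix_div he hj, hpow, ← mul_assoc, hsq]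
    ring

lemma Icc_div_eq_image (a : ℝ) {c : ℝ} (hc : 0 < c) :
    Set.Icc (a / c) ((a + 1) / c) = (fun t => (a + t) / c) '' Set.Icc 0 1 := by
  ext y
  constructor
  · rintro ⟨h0, h1⟩
    rw [div_le_iff₀ hc] at h0
    rw [le_div_iff₀ hc] at h1
    exact ⟨y * c - a, ⟨by linarith, by linarith⟩, by field_simp; ring⟩
  · rintro ⟨t, ⟨h0, h1⟩, rfl⟩
    constructor <;> dsimp only <;> gcongr
    linarith

/-- For every balanced pair `(k, m)` there is a balanced pair `(k', m)` of the
same order with `D_j(k'/2^{2m}) = |D_j(k/2^{2m})|` for all `1 ≤ j ≤ 2m` (so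
`(k', m)` is principal and of the same generation), with
`f(k/2^{2m}) = f(k'/2^{2m})` and `f(I(k, m)) = f(I(k', m))`. -/
theorem exists_principal_pair (r : ℕ → ℝ) (hr : ∀ n, r n = 1 ∨ r n = -1)
    (k m : ℕ) (hb : BalancedPair r k m) :
    ∃ k' : ℕ, BalancedPair r k' m ∧
      (∀ j, 1 ≤ j → j ≤ 2 * m →
        Dfun r j ((k' : ℝ) / 2 ^ (2 * m)) = |Dfun r j ((k : ℝ) / 2 ^ (2 * m))|) ∧
      (∀ j, 1 ≤ j → j ≤ 2 * m → 0 ≤ Dfun r j ((k' : ℝ) / 2 ^ (2 * m))) ∧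
      generation r k' m = generation r k m ∧
      takagi r ((k : ℝ) / 2 ^ (2 * m)) = takagi r ((k' : ℝ) / 2 ^ (2 * m)) ∧
      takagi r '' Set.Icc ((k : ℝ) / 2 ^ (2 * m)) (((k : ℝ) + 1) / 2 ^ (2 * m)) =
        takagi r '' Set.Icc ((k' : ℝ) / 2 ^ (2 * m)) (((k' : ℝ) + 1) / 2 ^ (2 * m)) := by
  obtain ⟨k', hk', habs⟩ := exists_Dfun_eq_abs hr ((k : ℝ) / 2 ^ (2 * m)) (2 * m)
  have hD' : Dfun r (2 * m) ((k' : ℝ) / 2 ^ (2 * m)) = 0 := by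
    rw [habs _ le_rfl, hb.2, abs_zero]
  have hf : ∀ t ∈ Set.Icc (0 : ℝ) 1, takagi r (((k : ℝ) + t) / 2 ^ (2 * m)) =
      takagi r (((k' : ℝ) + t) / 2 ^ (2 * m)) := fun t ht => by
    rw [takagi_add_div_of_Dfun_eq_zero hr hb.2 ht.1 ht.2,
      takagi_add_div_of_Dfun_eq_zero hr hD' ht.1 ht.2, midpointValue_congr hr habs]
  refine ⟨k', ⟨hk', hD'⟩, fun j _ hj => habs j hj, fun j _ hj => ?_, ?_, ?_, ?_⟩
  · rw [habs j hj]
    exact abs_nonneg _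
  · unfold generation
    congr 1
    ext j
    simp only [Set.mem_ofPred_eq]
    refine and_congr_right fun _ => and_congr_right fun hj => ?_
    rw [habs j hj, abs_eq_zero]
  · simpa using hf 0 (by simp)
  · rw [Icc_div_eq_image _ (by positivity), Icc_div_eq_image _ (by positivity), Set.image_image,
      Set.image_image]
    exact Set.image_congr hf
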